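/- arXiv:1712.09268 — 3 statements merged into one kernel-verified Lean document; each statement's English description precedes it below -/
import Mathlib

section
/- Let K be a field of characteristic zero, g a finite-dimensional K-vector space, β: g⊗g→g a Lie bracket on g, and γ: g*⊗g*→g* a Lie bracket on the dual space g*. Let δ: g→g⊗g be the unique linear map with γ(ξ⊗η)(x) = (ξ⊗η)(δ(x)) for all ξ,η ∈ g*, x ∈ g. Define on D = g ⊕ g* the bilinear bracket [(x,ξ),(y,η)] := (β(x⊗y) + ad*_ξ y − ad*_η x, γ(ξ⊗η) + ad*_x η − ad*_y ξ). Then this bracket is antisymmetric, restricts to β on g⊗g and to γ on g*⊗g*, the canonical symmetric bilinear form on g⊕g* is invariant under it, and it satisfies the Jacobi identity if and only if δ satisfies the 1-cocycle condition with respect to β. -/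
open TensorProduct

/-- Two tensors agree as soon as all pure tensors of linear forms agree on them. -/
theorem TensorProduct.eq_of_forall_dualDistrib {K V W : Type*} [Field K]
    [AddCommGroup V] [Module K V] [FiniteDimensional K V]
    [AddCommGroup W] [Module K W] [FiniteDimensional K W] {s t : V ⊗[K] W}
    (h : ∀ (ξ : Module.Dual K V) (η : Module.Dual K W),
      dualDistrib K V W (ξ ⊗ₜ[K] η) s = dualDistrib K V W (ξ ⊗ₜ[K] η) t) : s = t := by
  rw [← sub_eq_zero, ← Module.forall_dual_apply_eq_zero_iff K]
  intro f
  obtain ⟨p, rfl⟩ := (dualDistribEquiv K V W).surjective f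
  change dualDistrib K V W p (s - t) = 0
  induction p with
  | zero => simp
  | tmul ξ η => rw [map_sub, h, sub_self]
  | add p q hp hq => rw [map_add, LinearMap.add_apply, hp, hq, add_zero]

/-- Pairing with `map f h t` is pairing with `t` after precomposing the two linear forms. -/
theorem TensorProduct.dualDistrib_map {K V W : Type*} [CommRing K]
    [AddCommGroup V] [Module K V] [AddCommGroup W] [Module K W]
    (ξ : Module.Dual K V) (η : Module.Dual K W) (f : V →ₗ[K] V) (h : W →ₗ[K] W) (t : V ⊗[K] W) :
    dualDistrib K V W (ξ ⊗ₜ[K] η) (map f h t) =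
      dualDistrib K V W ((ξ ∘ₗ f) ⊗ₜ[K] (η ∘ₗ h)) t := by
  induction t with
  | zero => simp
  | tmul x y => simp
  | add p q hp hq => simp only [map_add, hp, hq]

/-- Manin triple bracket.  Let `K` be a field of characteristic zero, `g` a
finite-dimensional `K`-vector space, `β : g ⊗ g → g` a Lie bracket on `g` and
`γ : g* ⊗ g* → g*` a Lie bracket on the dual space.  Let `δ : g → g ⊗ g` be the (unique)
linear map with `γ(ξ ⊗ η)(x) = (ξ ⊗ η)(δ x)`, and let `coadβ`/`coadγ` be the coadjoint
actions.  Define on `D = g ⊕ g*` the bracket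
`[(x,ξ),(y,η)] = (β(x⊗y) + ad*_ξ y − ad*_η x, γ(ξ⊗η) + ad*_x η − ad*_y ξ)`.
Then this bracket is antisymmetric, restricts to `β` on `g ⊗ g` and to `γ` on `g* ⊗ g*`,
the canonical symmetric form `⟨(x,ξ),(y,η)⟩ = ξ(y) + η(x)` is invariant under it, and it
satisfies the Jacobi identity iff `δ` is a `1`-cocycle with respect to `β`. -/
theorem manin_triple_bracket
    (K : Type*) [Field K] [CharZero K]
    (g : Type*) [AddCommGroup g] [Module K g] [FiniteDimensional K g]
    (β : g ⊗[K] g →ₗ[K] g)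
    (hβanti : ∀ x y : g, β (x ⊗ₜ[K] y) = - β (y ⊗ₜ[K] x))
    (hβjac : ∀ x y z : g,
      β (β (x ⊗ₜ[K] y) ⊗ₜ[K] z) + β (β (y ⊗ₜ[K] z) ⊗ₜ[K] x) + β (β (z ⊗ₜ[K] x) ⊗ₜ[K] y) = 0)
    (γ : Module.Dual K g ⊗[K] Module.Dual K g →ₗ[K] Module.Dual K g)
    (hγanti : ∀ ξ η : Module.Dual K g, γ (ξ ⊗ₜ[K] η) = - γ (η ⊗ₜ[K] ξ))
    (hγjac : ∀ ξ η ζ : Module.Dual K g,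
      γ (γ (ξ ⊗ₜ[K] η) ⊗ₜ[K] ζ) + γ (γ (η ⊗ₜ[K] ζ) ⊗ₜ[K] ξ) + γ (γ (ζ ⊗ₜ[K] ξ) ⊗ₜ[K] η) = 0)
    (δ : g →ₗ[K] g ⊗[K] g)
    (hδ : ∀ (ξ η : Module.Dual K g) (x : g),
      γ (ξ ⊗ₜ[K] η) x = TensorProduct.dualDistrib K g g (ξ ⊗ₜ[K] η) (δ x))
    -- the coadjoint action of `g` on `g*` : `(ad*_x η)(z) = − η (β (x ⊗ z))`
    (coadβ : g → Module.Dual K g → Module.Dual K g)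
    (hcoadβ : ∀ (x : g) (η : Module.Dual K g) (z : g), coadβ x η z = - η (β (x ⊗ₜ[K] z)))
    -- the coadjoint action of `g*` on `g` : `η (ad*_ξ y) = − γ (ξ ⊗ η) y`
    (coadγ : Module.Dual K g → g → g)
    (hcoadγ : ∀ (ξ : Module.Dual K g) (y : g) (η : Module.Dual K g),
      η (coadγ ξ y) = - γ (ξ ⊗ₜ[K] η) y)
    -- the bracket on `D = g ⊕ g*`
    (B : g × Module.Dual K g → g × Module.Dual K g → g × Module.Dual K g)
    (hB : ∀ (x y : g) (ξ η : Module.Dual K g),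
      B (x, ξ) (y, η) =
        (β (x ⊗ₜ[K] y) + coadγ ξ y - coadγ η x,
         γ (ξ ⊗ₜ[K] η) + coadβ x η - coadβ y ξ)) :
    -- antisymmetry
    (∀ u v : g × Module.Dual K g, B u v = - B v u) ∧
    -- restriction to `g`
    (∀ x y : g, B (x, 0) (y, 0) = (β (x ⊗ₜ[K] y), 0)) ∧
    -- restriction to `g*`
    (∀ ξ η : Module.Dual K g, B (0, ξ) (0, η) = (0, γ (ξ ⊗ₜ[K] η))) ∧
    -- invariance of the canonical symmetric bilinear form `⟨(x,ξ),(y,η)⟩ = ξ y + η x`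
    (∀ u v w : g × Module.Dual K g,
      ((B u v).2 w.1 + w.2 (B u v).1) + (v.2 (B u w).1 + (B u w).2 v.1) = 0) ∧
    -- Jacobi identity ↔ `δ` is a 1-cocycle with respect to `β`
    ((∀ u v w : g × Module.Dual K g, B (B u v) w + B (B v w) u + B (B w u) v = 0) ↔
      (∀ x y : g, δ (β (x ⊗ₜ[K] y)) =
        (TensorProduct.map (β ∘ₗ TensorProduct.mk K g g x) (LinearMap.id : g →ₗ[K] g)
          + TensorProduct.map (LinearMap.id : g →ₗ[K] g) (β ∘ₗ TensorProduct.mk K g g x)) (δ y)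
        - (TensorProduct.map (β ∘ₗ TensorProduct.mk K g g y) (LinearMap.id : g →ₗ[K] g)
          + TensorProduct.map (LinearMap.id : g →ₗ[K] g) (β ∘ₗ TensorProduct.mk K g g y)) (δ x))) := by
  have γ_neg_left (ξ η : Module.Dual K g) : γ ((-ξ) ⊗ₜ[K] η) = - γ (ξ ⊗ₜ[K] η) := by
    rw [← neg_one_smul K ξ, ← smul_tmul', map_smul]
    exact neg_one_smul K (γ (ξ ⊗ₜ[K] η))
  have γ_neg_right (ξ η : Module.Dual K g) : γ (ξ ⊗ₜ[K] (-η)) = - γ (ξ ⊗ₜ[K] η) := by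
    rw [hγanti, γ_neg_left, hγanti η, neg_neg]
  have cocycle_iff : ∀ x y : g, (δ (β (x ⊗ₜ[K] y)) =
        (TensorProduct.map (β ∘ₗ TensorProduct.mk K g g x) (LinearMap.id : g →ₗ[K] g)
          + TensorProduct.map (LinearMap.id : g →ₗ[K] g) (β ∘ₗ TensorProduct.mk K g g x)) (δ y)
        - (TensorProduct.map (β ∘ₗ TensorProduct.mk K g g y) (LinearMap.id : g →ₗ[K] g)
          + TensorProduct.map (LinearMap.id : g →ₗ[K] g) (β ∘ₗ TensorProduct.mk K g g y)) (δ x)) ↔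
      ∀ ξ η : Module.Dual K g, γ (ξ ⊗ₜ[K] η) (β (x ⊗ₜ[K] y)) =
        - γ (coadβ x ξ ⊗ₜ[K] η) y - γ (ξ ⊗ₜ[K] coadβ x η) y
        + γ (coadβ y ξ ⊗ₜ[K] η) x + γ (ξ ⊗ₜ[K] coadβ y η) x := by
    have comp_ad (x : g) (ξ : Module.Dual K g) :
        ξ ∘ₗ β ∘ₗ TensorProduct.mk K g g x = - coadβ x ξ := by
      ext z; simp [hcoadβ]
    intro x y
    have key (ξ η : Module.Dual K g) : dualDistrib K g g (ξ ⊗ₜ[K] η)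
        ((TensorProduct.map (β ∘ₗ TensorProduct.mk K g g x) (LinearMap.id : g →ₗ[K] g)
          + TensorProduct.map (LinearMap.id : g →ₗ[K] g) (β ∘ₗ TensorProduct.mk K g g x)) (δ y)
        - (TensorProduct.map (β ∘ₗ TensorProduct.mk K g g y) (LinearMap.id : g →ₗ[K] g)
          + TensorProduct.map (LinearMap.id : g →ₗ[K] g) (β ∘ₗ TensorProduct.mk K g g y)) (δ x)) =
        - γ (coadβ x ξ ⊗ₜ[K] η) y - γ (ξ ⊗ₜ[K] coadβ x η) y
        + γ (coadβ y ξ ⊗ₜ[K] η) x + γ (ξ ⊗ₜ[K] coadβ y η) x := by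
      simp only [map_sub, LinearMap.add_apply, map_add, dualDistrib_map, LinearMap.comp_id, comp_ad]
      simp only [← hδ, γ_neg_left, γ_neg_right, LinearMap.neg_apply]
      ring
    constructor
    · intro h ξ η
      rw [hδ, h, key]
    · intro h
      refine eq_of_forall_dualDistrib fun ξ η ↦ ?_
      rw [key, ← hδ, h]
  have pair_coadγ (ξ φ : Module.Dual K g) (y z : g) :
      φ (β (coadγ ξ y ⊗ₜ[K] z)) = - γ (ξ ⊗ₜ[K] coadβ z φ) y := by
    rw [hβanti, map_neg, ← hcoadβ, hcoadγ]
  have ext_dual {x y : g} (h : ∀ φ : Module.Dual K g, φ x = φ y) : x = y :=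
    sub_eq_zero.1 ((Module.forall_dual_apply_eq_zero_iff K _).1 fun φ ↦ by
      rw [map_sub, h, sub_self])
  have coadγ_zero (ξ : Module.Dual K g) : coadγ ξ 0 = 0 :=
    ext_dual fun φ ↦ by simp [hcoadγ]
  have zero_coadγ (x : g) : coadγ 0 x = 0 :=
    ext_dual fun φ ↦ by simp [hcoadγ]
  have coadβ_zero (x : g) : coadβ x 0 = 0 := by ext z; simp [hcoadβ]
  have zero_coadβ (ξ : Module.Dual K g) : coadβ 0 ξ = 0 := by ext z; simp [hcoadβ]
  have γ_anti (ξ η : Module.Dual K g) (x : g) :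
      γ (ξ ⊗ₜ[K] η) x + γ (η ⊗ₜ[K] ξ) x = 0 := by
    rw [hγanti, LinearMap.neg_apply, neg_add_cancel]
  have γ_leibniz (ξ η ζ : Module.Dual K g) (x : g) :
      γ (γ (ξ ⊗ₜ[K] η) ⊗ₜ[K] ζ) x =
        γ (ξ ⊗ₜ[K] γ (η ⊗ₜ[K] ζ)) x - γ (η ⊗ₜ[K] γ (ξ ⊗ₜ[K] ζ)) x := by
    have h := congrArg (fun f : Module.Dual K g ↦ f x) (hγjac ξ η ζ)
    have h' : γ (γ (ζ ⊗ₜ[K] ξ) ⊗ₜ[K] η) x = - γ (γ (ξ ⊗ₜ[K] ζ) ⊗ₜ[K] η) x := by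
      rw [hγanti ζ ξ, γ_neg_left, LinearMap.neg_apply]
    simp only [LinearMap.add_apply, LinearMap.zero_apply] at h
    linear_combination h - h' - γ_anti ξ (γ (η ⊗ₜ[K] ζ)) x + γ_anti η (γ (ξ ⊗ₜ[K] ζ)) x
  have β_leibniz (φ : Module.Dual K g) (x y z : g) :
      φ (β (β (x ⊗ₜ[K] y) ⊗ₜ[K] z)) =
        φ (β (x ⊗ₜ[K] β (y ⊗ₜ[K] z))) - φ (β (y ⊗ₜ[K] β (x ⊗ₜ[K] z))) := by
    have h := congrArg φ (hβjac x y z)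
    rw [hβanti x (β (y ⊗ₜ[K] z)), hβanti y (β (x ⊗ₜ[K] z)), hβanti x z, neg_tmul]
    simp only [map_add, map_neg, map_zero] at h ⊢
    linear_combination h
  simp_rw [cocycle_iff]
  refine ⟨?_, ?_, ?_, ?_, ?_, ?_⟩
  · rintro ⟨x, ξ⟩ ⟨y, η⟩
    rw [hB, hB, hβanti x y, hγanti ξ η, Prod.neg_mk]
    congr 1 <;> abel
  · intro x y
    simp [hB, zero_coadγ, coadβ_zero]
  · intro ξ η
    simp [hB, coadγ_zero, zero_coadβ]
  · rintro ⟨x, ξ⟩ ⟨y, η⟩ ⟨z, ζ⟩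
    simp only [hB, map_add, map_sub, LinearMap.add_apply, LinearMap.sub_apply, hcoadβ, hcoadγ]
    have h := congrArg ξ (hβanti y z)
    rw [map_neg] at h
    linear_combination h + γ_anti η ζ x
  · intro hJ x y ξ η
    have h := congrArg (fun p ↦ η p.1) (hJ (x, 0) (y, 0) (0, ξ))
    simp only [hB, zero_tmul, tmul_zero, map_zero, coadγ_zero, zero_coadγ, coadβ_zero, zero_add,
      add_zero, sub_zero, zero_sub, Prod.fst_add, Prod.fst_zero, map_add, γ_neg_left,
      LinearMap.neg_apply, hcoadγ] at h
    simp only [neg_tmul, map_neg, hcoadγ, pair_coadγ] at h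
    linear_combination h
  · rintro hC ⟨x, ξ⟩ ⟨y, η⟩ ⟨z, ζ⟩
    refine Prod.ext (ext_dual fun φ ↦ ?_) (LinearMap.ext fun t ↦ ?_)
    · simp only [hB, Prod.fst_add, Prod.fst_zero, map_add, map_sub, map_zero, add_tmul, sub_tmul,
        LinearMap.add_apply, LinearMap.sub_apply, hcoadγ, pair_coadγ]
      have h := congrArg φ (hβjac x y z)
      simp only [map_add, map_zero] at h
      linear_combination h + hC x y ζ φ + hC y z ξ φ + hC z x η φ
        - γ_leibniz ξ η φ z - γ_leibniz η ζ φ x - γ_leibniz ζ ξ φ y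
    · simp only [hB, Prod.snd_add, Prod.snd_zero, map_add, map_sub, add_tmul, sub_tmul,
        LinearMap.add_apply, LinearMap.sub_apply, LinearMap.zero_apply, pair_coadγ, hcoadβ]
      have h := congrArg (fun f : Module.Dual K g ↦ f t) (hγjac ξ η ζ)
      simp only [LinearMap.add_apply, LinearMap.zero_apply] at h
      linear_combination h + hC z t ξ η + hC x t η ζ + hC y t ζ ξ
        - β_leibniz ζ x y t - β_leibniz ξ y z t - β_leibniz η z x t
        + γ_anti η (coadβ t ξ) z + γ_anti ζ (coadβ t η) x + γ_anti ξ (coadβ t ζ) y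
        - γ_anti ξ (coadβ z η) t - γ_anti η (coadβ x ζ) t - γ_anti ζ (coadβ y ξ) t
end

section
/- Let K be a field of characteristic zero, g a finite-dimensional K-vector space, β: g⊗g→g a Lie bracket on g, and γ: g*⊗g*→g* a Lie bracket on g*. If B: D⊗D→D is any antisymmetric bilinear map on D = g ⊕ g* such that B restricts to β on g⊗g, B restricts to γ on g*⊗g*, and the canonical symmetric bilinear form on g⊕g* is invariant under B, then B is equal to the bracket [(x,ξ),(y,η)] = (β(x⊗y) + ad*_ξ y − ad*_η x, γ(ξ⊗η) + ad*_x η − ad*_y ξ). -/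
open TensorProduct

/-- uniqueness of the Manin triple bracket.  Let `K` be a field of
characteristic zero, `g` a finite-dimensional `K`-vector space, `β : g ⊗ g → g` a Lie
bracket on `g` and `γ : g* ⊗ g* → g*` a Lie bracket on `g*`.  If `B : D ⊗ D → D` is any
antisymmetric bilinear map on `D = g ⊕ g*` which restricts to `β` on `g ⊗ g`, restricts
to `γ` on `g* ⊗ g*`, and leaves the canonical symmetric bilinear form
`⟨(x,ξ),(y,η)⟩ = ξ(y) + η(x)` invariant, then `B` equals the bracket
`[(x,ξ),(y,η)] = (β(x⊗y) + ad*_ξ y − ad*_η x, γ(ξ⊗η) + ad*_x η − ad*_y ξ)`. -/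
theorem manin_triple_bracket_unique
    (K : Type*) [Field K] [CharZero K]
    (g : Type*) [AddCommGroup g] [Module K g] [FiniteDimensional K g]
    (β : g ⊗[K] g →ₗ[K] g)
    (hβanti : ∀ x y : g, β (x ⊗ₜ[K] y) = - β (y ⊗ₜ[K] x))
    (hβjac : ∀ x y z : g,
      β (β (x ⊗ₜ[K] y) ⊗ₜ[K] z) + β (β (y ⊗ₜ[K] z) ⊗ₜ[K] x) + β (β (z ⊗ₜ[K] x) ⊗ₜ[K] y) = 0)
    (γ : Module.Dual K g ⊗[K] Module.Dual K g →ₗ[K] Module.Dual K g)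
    (hγanti : ∀ ξ η : Module.Dual K g, γ (ξ ⊗ₜ[K] η) = - γ (η ⊗ₜ[K] ξ))
    (hγjac : ∀ ξ η ζ : Module.Dual K g,
      γ (γ (ξ ⊗ₜ[K] η) ⊗ₜ[K] ζ) + γ (γ (η ⊗ₜ[K] ζ) ⊗ₜ[K] ξ) + γ (γ (ζ ⊗ₜ[K] ξ) ⊗ₜ[K] η) = 0)
    -- the coadjoint action of `g` on `g*` : `(ad*_x η)(z) = − η (β (x ⊗ z))`
    (coadβ : g → Module.Dual K g → Module.Dual K g)
    (hcoadβ : ∀ (x : g) (η : Module.Dual K g) (z : g), coadβ x η z = - η (β (x ⊗ₜ[K] z)))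
    -- the coadjoint action of `g*` on `g` : `η (ad*_ξ y) = − γ (ξ ⊗ η) y`
    (coadγ : Module.Dual K g → g → g)
    (hcoadγ : ∀ (ξ : Module.Dual K g) (y : g) (η : Module.Dual K g),
      η (coadγ ξ y) = - γ (ξ ⊗ₜ[K] η) y)
    -- `B` is a bilinear map on `D = g ⊕ g*` …
    (B : (g × Module.Dual K g) ⊗[K] (g × Module.Dual K g) →ₗ[K] g × Module.Dual K g)
    -- … which is antisymmetric,
    (hBanti : ∀ u v : g × Module.Dual K g, B (u ⊗ₜ[K] v) = - B (v ⊗ₜ[K] u))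
    -- restricts to `β` on `g ⊗ g`,
    (hBβ : ∀ x y : g, B ((x, (0 : Module.Dual K g)) ⊗ₜ[K] (y, (0 : Module.Dual K g)))
      = (β (x ⊗ₜ[K] y), 0))
    -- restricts to `γ` on `g* ⊗ g*`,
    (hBγ : ∀ ξ η : Module.Dual K g, B (((0 : g), ξ) ⊗ₜ[K] ((0 : g), η))
      = (0, γ (ξ ⊗ₜ[K] η)))
    -- and leaves the canonical symmetric bilinear form invariant :
    (hBinv : ∀ u v w : g × Module.Dual K g,
      ((B (u ⊗ₜ[K] v)).2 w.1 + w.2 (B (u ⊗ₜ[K] v)).1)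
        + (v.2 (B (u ⊗ₜ[K] w)).1 + (B (u ⊗ₜ[K] w)).2 v.1) = 0) :
    ∀ (x y : g) (ξ η : Module.Dual K g),
      B ((x, ξ) ⊗ₜ[K] (y, η)) =
        (β (x ⊗ₜ[K] y) + coadγ ξ y - coadγ η x,
         γ (ξ ⊗ₜ[K] η) + coadβ x η - coadβ y ξ) := by
  have mixed : ∀ (y : g) (ξ : Module.Dual K g),
      B (((0 : g), ξ) ⊗ₜ[K] (y, (0 : Module.Dual K g))) = (coadγ ξ y, - coadβ y ξ) := by
    intro y ξ
    refine Prod.ext ?_ ?_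
    · rw [← sub_eq_zero, ← Module.forall_dual_apply_eq_zero_iff K]
      intro ζ
      have h := hBinv (0, ξ) (y, 0) (0, ζ)
      rw [hBγ] at h
      simp only [map_zero, zero_add] at h
      simp only [map_sub, hcoadγ]
      linear_combination h
    · rw [hBanti]
      ext z
      have h := hBinv (y, 0) (0, ξ) (z, 0)
      rw [hBβ] at h
      simp only [map_zero, add_zero, LinearMap.zero_apply] at h
      simp only [Prod.snd_neg, LinearMap.neg_apply, hcoadβ]
      linear_combination -h
  intro x y ξ η
  have split : ∀ (z : g) (ζ : Module.Dual K g),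
      (z, ζ) = (z, (0 : Module.Dual K g)) + ((0 : g), ζ) := by simp
  rw [split x ξ, split y η, TensorProduct.add_tmul, TensorProduct.tmul_add,
    TensorProduct.tmul_add, map_add, map_add, map_add, hBβ, hBγ, mixed,
    hBanti (x, 0) (0, η), mixed]
  refine Prod.ext ?_ ?_
  · simp only [Prod.fst_add, Prod.fst_neg]
    abel
  · simp only [Prod.snd_add, Prod.snd_neg]
    abel
end

section
/- Let K be a field of characteristic zero, g a finite-dimensional K-vector space, β: g⊗g→g an antisymmetric bilinear map, and δ: g→g⊗g a linear map with flip∘δ = −δ. Let γ := δ^∨: g*⊗g*→g*, defined by γ(ξ⊗η)(x) = (ξ⊗η)(δ(x)), and let β^∨: g*→g*⊗g* be the unique linear map with β^∨(ξ)(x⊗y) = ξ(β(x⊗y)) under the canonical isomorphism g*⊗g* ≅ (g⊗g)*. Then δ satisfies the 1-cocycle condition with respect to β if and only if β^∨ satisfies the 1-cocycle condition with respect to γ. -/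
open TensorProduct

noncomputable section

variable (K : Type*) [Field K] (M : Type*) [AddCommGroup M] [Module K M]

/-- A bracket `b : M ⊗ M → M` is antisymmetric. -/
def IsBracketAntisymm (b : M ⊗[K] M →ₗ[K] M) : Prop :=
  ∀ x y : M, b (x ⊗ₜ[K] y) = - b (y ⊗ₜ[K] x)

/-- A cobracket `d : M → M ⊗ M` satisfies `flip ∘ d = −d`. -/
def IsCoAntisymm (d : M →ₗ[K] M ⊗[K] M) : Prop :=
  ∀ x : M, TensorProduct.comm K M M (d x) = - d x

/-- The 1-cocycle condition for `d : M → M ⊗ M` with respect to the bracket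
`b : M ⊗ M → M` : writing `ad_x = b (x ⊗ ·)`,
`d (b (x ⊗ y)) = (ad_x ⊗ id + id ⊗ ad_x) (d y) − (ad_y ⊗ id + id ⊗ ad_y) (d x)`. -/
def IsOneCocycle (b : M ⊗[K] M →ₗ[K] M) (d : M →ₗ[K] M ⊗[K] M) : Prop :=
  ∀ x y : M, d (b (x ⊗ₜ[K] y)) =
    (TensorProduct.map (b ∘ₗ TensorProduct.mk K M M x) (LinearMap.id : M →ₗ[K] M)
      + TensorProduct.map (LinearMap.id : M →ₗ[K] M) (b ∘ₗ TensorProduct.mk K M M x)) (d y)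
    - (TensorProduct.map (b ∘ₗ TensorProduct.mk K M M y) (LinearMap.id : M →ₗ[K] M)
      + TensorProduct.map (LinearMap.id : M →ₗ[K] M) (b ∘ₗ TensorProduct.mk K M M y)) (d x)

namespace TensorProduct

open Module in
theorem dualDistrib_tmul_map {R M N P Q : Type*} [CommRing R] [AddCommGroup M] [AddCommGroup N]
    [AddCommGroup P] [AddCommGroup Q] [Module R M] [Module R N] [Module R P] [Module R Q]
    (ξ : Dual R P) (η : Dual R Q) (f : M →ₗ[R] P) (h : N →ₗ[R] Q) (z : M ⊗[R] N) :
    dualDistrib R P Q (ξ ⊗ₜ[R] η) (map f h z) =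
      dualDistrib R M N ((ξ ∘ₗ f) ⊗ₜ[R] (η ∘ₗ h)) z := by
  induction z with
  | zero => simp
  | tmul m n => simp
  | add a b ha hb => simp only [map_add, ha, hb]

open Module in
theorem dualDistrib_injective_of_finite {F V W : Type*} [Field F] [AddCommGroup V]
    [AddCommGroup W] [Module F V] [Module F W] [FiniteDimensional F V] [FiniteDimensional F W] :
    Function.Injective (dualDistrib F V W) :=
  (dualDistribEquiv F V W).injective

open Module in
theorem eq_iff_forall_dualDistrib_tmul {F V W : Type*} [Field F] [AddCommGroup V]
    [AddCommGroup W] [Module F V] [Module F W] [FiniteDimensional F V] [FiniteDimensional F W]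
    {z w : V ⊗[F] W} :
    z = w ↔ ∀ (ξ : Dual F V) (η : Dual F W),
      dualDistrib F V W (ξ ⊗ₜ[F] η) z = dualDistrib F V W (ξ ⊗ₜ[F] η) w := by
  refine ⟨fun h _ _ => by rw [h], fun h => ?_⟩
  refine sub_eq_zero.1 ((forall_dual_apply_eq_zero_iff F (z - w)).1 fun φ => ?_)
  rw [map_sub, sub_eq_zero]
  obtain ⟨t, rfl⟩ := (dualDistribEquiv F V W).surjective φ
  change dualDistrib F V W t z = dualDistrib F V W t w
  induction t with
  | zero => simp
  | tmul ξ η => exact h ξ η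
  | add a b ha hb => simp only [map_add, LinearMap.add_apply, ha, hb]

open Module in
theorem eq_iff_forall_dualDistrib_apply_tmul {F V W : Type*} [Field F] [AddCommGroup V]
    [AddCommGroup W] [Module F V] [Module F W] [FiniteDimensional F V] [FiniteDimensional F W]
    {s t : Dual F V ⊗[F] Dual F W} :
    s = t ↔ ∀ (x : V) (y : W),
      dualDistrib F V W s (x ⊗ₜ[F] y) = dualDistrib F V W t (x ⊗ₜ[F] y) :=
  ⟨fun h _ _ => by rw [h], fun h => dualDistrib_injective_of_finite (TensorProduct.ext' h)⟩

section DualBracket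

open Module

variable {R V : Type*} [CommRing R] [AddCommGroup V] [Module R V]
  {δ : V →ₗ[R] V ⊗[R] V} {γ : Dual R V ⊗[R] Dual R V →ₗ[R] Dual R V}

theorem dualDistrib_map_dualBracket_id
    (hγ : ∀ (ξ η : Dual R V) (x : V),
      γ (ξ ⊗ₜ[R] η) x = dualDistrib R V V (ξ ⊗ₜ[R] η) (δ x))
    (ξ : Dual R V) (t : Dual R V ⊗[R] Dual R V) (x y : V) :
    dualDistrib R V V (map (γ ∘ₗ mk R (Dual R V) (Dual R V) ξ) LinearMap.id t) (x ⊗ₜ[R] y) =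
      dualDistrib R V V (ξ ⊗ₜ[R] (dualDistrib R V V t ∘ₗ (mk R V V).flip y)) (δ x) := by
  induction t with
  | zero => simp
  | tmul a b =>
    have h : dualDistrib R V V (a ⊗ₜ[R] b) ∘ₗ (mk R V V).flip y = b y • a := by
      ext v; simp [mul_comm]
    simp [h, hγ, mul_comm]
  | add a b ha hb =>
    simp only [map_add, LinearMap.add_apply, LinearMap.add_comp, tmul_add, ha, hb]

theorem dualDistrib_map_id_dualBracket
    (hγ : ∀ (ξ η : Dual R V) (x : V),
      γ (ξ ⊗ₜ[R] η) x = dualDistrib R V V (ξ ⊗ₜ[R] η) (δ x))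
    (ξ : Dual R V) (t : Dual R V ⊗[R] Dual R V) (x y : V) :
    dualDistrib R V V (map LinearMap.id (γ ∘ₗ mk R (Dual R V) (Dual R V) ξ) t) (x ⊗ₜ[R] y) =
      dualDistrib R V V (ξ ⊗ₜ[R] (dualDistrib R V V t ∘ₗ mk R V V x)) (δ y) := by
  induction t with
  | zero => simp
  | tmul a b =>
    have h : dualDistrib R V V (a ⊗ₜ[R] b) ∘ₗ mk R V V x = a x • b := by
      ext v; simp
    simp [h, hγ]
  | add a b ha hb =>
    simp only [map_add, LinearMap.add_apply, LinearMap.add_comp, tmul_add, ha, hb]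

theorem dualDistrib_tmul_swap_of_comm_eq_neg (ξ η : Dual R V) {z : V ⊗[R] V}
    (hz : TensorProduct.comm R V V z = -z) :
    dualDistrib R V V (η ⊗ₜ[R] ξ) z = -dualDistrib R V V (ξ ⊗ₜ[R] η) z := by
  rw [← comm_tmul R, ← dualDistrib_apply_comm, hz, map_neg]

end DualBracket

end TensorProduct


/-- self-duality of the 1-cocycle condition.  Let `K` be a field of
characteristic zero, `g` a finite-dimensional `K`-vector space, `β : g ⊗ g → g`
antisymmetric, and `δ : g → g ⊗ g` with `flip ∘ δ = −δ`.  Let `γ = δ^∨ : g* ⊗ g* → g*`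
be defined by `γ(ξ ⊗ η)(x) = (ξ ⊗ η)(δ x)` and let `β^∨ : g* → g* ⊗ g*` be the unique
linear map with `β^∨(ξ)(x ⊗ y) = ξ(β(x ⊗ y))` (under `g* ⊗ g* ≅ (g ⊗ g)*`).  Then `δ`
satisfies the 1-cocycle condition with respect to `β` iff `β^∨` satisfies the 1-cocycle
condition with respect to `γ`. -/
theorem one_cocycle_dual
    (g : Type*) [AddCommGroup g] [Module K g] [FiniteDimensional K g] [CharZero K]
    (β : g ⊗[K] g →ₗ[K] g) (hβanti : IsBracketAntisymm K g β)
    (δ : g →ₗ[K] g ⊗[K] g) (hδanti : IsCoAntisymm K g δ)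
    (γ : Module.Dual K g ⊗[K] Module.Dual K g →ₗ[K] Module.Dual K g)
    (hγ : ∀ (ξ η : Module.Dual K g) (x : g),
      γ (ξ ⊗ₜ[K] η) x = TensorProduct.dualDistrib K g g (ξ ⊗ₜ[K] η) (δ x))
    (βdual : Module.Dual K g →ₗ[K] Module.Dual K g ⊗[K] Module.Dual K g)
    (hβdual : ∀ (ξ : Module.Dual K g) (x y : g),
      TensorProduct.dualDistrib K g g (βdual ξ) (x ⊗ₜ[K] y) = ξ (β (x ⊗ₜ[K] y))) :
    IsOneCocycle K g β δ ↔ IsOneCocycle K (Module.Dual K g) γ βdual := by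
  have hright (ξ : Module.Dual K g) (x : g) :
      dualDistrib K g g (βdual ξ) ∘ₗ mk K g g x = ξ ∘ₗ β ∘ₗ mk K g g x := by
    ext v; simp [hβdual]
  have hleft (ξ : Module.Dual K g) (y : g) :
      dualDistrib K g g (βdual ξ) ∘ₗ (mk K g g).flip y = -(ξ ∘ₗ β ∘ₗ mk K g g y) := by
    ext v; simp [hβdual, hβanti v y]
  have hpair (x y : g) (ξ η : Module.Dual K g) :
      dualDistrib K g g (βdual (γ (ξ ⊗ₜ[K] η))) (x ⊗ₜ[K] y) =
        dualDistrib K g g (ξ ⊗ₜ[K] η) (δ (β (x ⊗ₜ[K] y))) := by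
    rw [hβdual, hγ]
  have hswap (ξ η : Module.Dual K g) (x : g) :=
    dualDistrib_tmul_swap_of_comm_eq_neg ξ η (hδanti x)
  have hneg (ξ η : Module.Dual K g) (z : g ⊗[K] g) :
      dualDistrib K g g (ξ ⊗ₜ[K] (-η)) z = -dualDistrib K g g (ξ ⊗ₜ[K] η) z :=
    LinearMap.congr_fun (map_neg (dualDistrib K g g ∘ₗ mk K _ _ ξ) η) z
  unfold IsOneCocycle
  simp only [eq_iff_forall_dualDistrib_tmul (V := g) (W := g),
    eq_iff_forall_dualDistrib_apply_tmul (V := g) (W := g), hpair, map_sub, map_add,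
    LinearMap.sub_apply, LinearMap.add_apply, dualDistrib_tmul_map,
    dualDistrib_map_dualBracket_id hγ, dualDistrib_map_id_dualBracket hγ, hleft, hright, hneg,
    LinearMap.comp_id]
  have key (x y : g) (ξ η : Module.Dual K g) :
      dualDistrib K g g ((ξ ∘ₗ β ∘ₗ mk K g g x) ⊗ₜ[K] η) (δ y) +
          dualDistrib K g g (ξ ⊗ₜ[K] (η ∘ₗ β ∘ₗ mk K g g x)) (δ y) -
        (dualDistrib K g g ((ξ ∘ₗ β ∘ₗ mk K g g y) ⊗ₜ[K] η) (δ x) +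
          dualDistrib K g g (ξ ⊗ₜ[K] (η ∘ₗ β ∘ₗ mk K g g y)) (δ x)) =
      -dualDistrib K g g (ξ ⊗ₜ[K] (η ∘ₗ β ∘ₗ mk K g g y)) (δ x) +
          dualDistrib K g g (ξ ⊗ₜ[K] (η ∘ₗ β ∘ₗ mk K g g x)) (δ y) -
        (-dualDistrib K g g (η ⊗ₜ[K] (ξ ∘ₗ β ∘ₗ mk K g g y)) (δ x) +
          dualDistrib K g g (η ⊗ₜ[K] (ξ ∘ₗ β ∘ₗ mk K g g x)) (δ y)) := by
    rw [hswap (ξ ∘ₗ β ∘ₗ mk K g g y) η, hswap (ξ ∘ₗ β ∘ₗ mk K g g x) η]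
    ring
  simp only [key]
  exact ⟨fun h ξ η x y => h x y ξ η, fun h x y ξ η => h ξ η x y⟩

end
end
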